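/- Let $n \ge 2$ and let $x=(x_1,\dots,x_n)$, $y=(y_1,\dots,y_n)$ be two bases of the free group $F_n$. Suppose $x'=(x'_1,\dots,x'_n)$ is a basis of $F_n$ for which there exists $v \in F_n$ with $x'_i = v^{-1} x_i v$ for all $i \in \{1,\dots,n\}$. Then $|x|_y \le 2\,|x'|_y^2\,|y|_x + |x'|_y$. -/

import Mathlib

/-- A family `b : Fin n → G` is a free basis of `G` if the induced homomorphism
from the free group on `Fin n` is an isomorphism; this makes `G` a free group
of rank `n` with basis `b`. -/
def IsFreeBasis {n : ℕ} {G : Type*} [Group G] (b : Fin n → G) : Prop :=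
  Function.Bijective (FreeGroup.lift b : FreeGroup (Fin n) →* G)

/-- The word length `|g|_b` of `g` with respect to the basis `b`: the length of the
reduced word (in the letters `b i ^ ±1`) representing `g`, i.e. the smallest length
of the reduced form of an element of the free group mapping to `g` under `b`. -/
noncomputable def wordLength {n : ℕ} {G : Type*} [Group G] (b : Fin n → G) (g : G) : ℕ :=
  sInf {k | ∃ w : FreeGroup (Fin n), FreeGroup.lift b w = g ∧ w.toWord.length = k}

/-- `basisNorm b b' = |b'|_b`, the maximum of the word lengths of the elements of `b'`
with respect to the basis `b`. -/
noncomputable def basisNorm {n : ℕ} {G : Type*} [Group G] (b b' : Fin n → G) : ℕ :=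
  Finset.univ.sup fun i => wordLength b (b' i)

section WordLength

variable {n : ℕ} {G : Type*} [Group G]

theorem wordLength_lift_le (b : Fin n → G) (w : FreeGroup (Fin n)) :
    wordLength b (FreeGroup.lift b w) ≤ w.norm :=
  Nat.sInf_le ⟨w, rfl, rfl⟩

namespace IsFreeBasis

variable {b : Fin n → G}

theorem exists_lift_eq (hb : IsFreeBasis b) (g : G) :
    ∃ w : FreeGroup (Fin n), FreeGroup.lift b w = g ∧ w.norm = wordLength b g := by
  obtain ⟨w, hw⟩ := hb.2 g
  exact Nat.sInf_mem (s := {k | ∃ w : FreeGroup (Fin n),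
    FreeGroup.lift b w = g ∧ w.toWord.length = k}) ⟨_, w, hw, rfl⟩

theorem wordLength_lift (hb : IsFreeBasis b) (w : FreeGroup (Fin n)) :
    wordLength b (FreeGroup.lift b w) = w.norm := by
  obtain ⟨u, hu, hn⟩ := hb.exists_lift_eq (FreeGroup.lift b w)
  rw [← hn, hb.1 hu]

theorem wordLength_mul_le (hb : IsFreeBasis b) (g h : G) :
    wordLength b (g * h) ≤ wordLength b g + wordLength b h := by
  obtain ⟨u, rfl, hu⟩ := hb.exists_lift_eq g
  obtain ⟨w, rfl, hw⟩ := hb.exists_lift_eq h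
  rw [← map_mul, ← hu, ← hw]
  exact (wordLength_lift_le b _).trans (FreeGroup.norm_mul_le u w)

theorem wordLength_inv (hb : IsFreeBasis b) (g : G) :
    wordLength b g⁻¹ = wordLength b g := by
  obtain ⟨u, rfl⟩ := hb.2 g
  rw [← map_inv, hb.wordLength_lift, hb.wordLength_lift, FreeGroup.norm_inv_eq]

end IsFreeBasis

theorem wordLength_le_basisNorm (b c : Fin n → G) (i : Fin n) :
    wordLength b (c i) ≤ basisNorm b c :=
  Finset.le_sup (f := fun i => wordLength b (c i)) (Finset.mem_univ i)

theorem IsFreeBasis.wordLength_lift_le_mul {b : Fin n → G} (hb : IsFreeBasis b) (c : Fin n → G)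
    (w : FreeGroup (Fin n)) :
    wordLength b (FreeGroup.lift c w) ≤ w.norm * basisNorm b c := by
  suffices h : ∀ L : List (Fin n × Bool),
      wordLength b (FreeGroup.lift c (FreeGroup.mk L)) ≤ L.length * basisNorm b c by
    simpa only [FreeGroup.mk_toWord, FreeGroup.norm] using h w.toWord
  intro L
  induction L with
  | nil => simpa using wordLength_lift_le b 1
  | cons a L ih =>
    have ha : wordLength b (FreeGroup.lift c (FreeGroup.mk [a])) ≤ basisNorm b c := by
      rcases a with ⟨i, _ | _⟩ <;>
        simpa [hb.wordLength_inv] using wordLength_le_basisNorm b c i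
    rw [← List.singleton_append, ← FreeGroup.mul_mk, map_mul, List.length_append, add_mul]
    refine (hb.wordLength_mul_le _ _).trans (add_le_add ?_ ih)
    simpa using ha

theorem FreeGroup.lift_conj {α : Type*} {x x' : α → G} {v : G}
    (h : ∀ i, x' i = v⁻¹ * x i * v) (w : FreeGroup α) :
    FreeGroup.lift x' w = v⁻¹ * FreeGroup.lift x w * v := by
  have : FreeGroup.lift x' = (MulAut.conj v⁻¹).toMonoidHom.comp (FreeGroup.lift x) := by
    ext i
    simp [h]
  simp [this]

end WordLength

theorem FreeGroup.exists_norm_conj_of {α : Type*} [DecidableEq α] [Nontrivial α]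
    (w : FreeGroup α) : ∃ i, (w⁻¹ * FreeGroup.of i * w).norm = 2 * w.norm + 1 := by
  obtain ⟨i, hi⟩ : ∃ i, ∀ a ∈ w.toWord.head?, i ≠ a.1 := by
    rcases w.toWord with _ | ⟨a, L⟩
    · obtain ⟨i⟩ := (inferInstance : Nonempty α)
      exact ⟨i, by simp⟩
    · obtain ⟨i, hi⟩ := exists_ne a.1
      exact ⟨i, by simpa using hi⟩
  have hred : FreeGroup.IsReduced (FreeGroup.invRev w.toWord ++ ([(i, true)] ++ w.toWord)) := by
    have h1 : FreeGroup.IsReduced w.toWord := FreeGroup.isReduced_toWord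
    have h2 : FreeGroup.IsReduced (FreeGroup.invRev w.toWord) := by
      rw [← FreeGroup.toWord_inv]
      exact FreeGroup.isReduced_toWord
    unfold FreeGroup.IsReduced at *
    refine List.isChain_append.2 ⟨h2, List.isChain_append.2 ⟨by simp, h1, ?_⟩, ?_⟩
    · intro a ha b hb hab
      simp only [List.getLast?_singleton, Option.mem_some_iff] at ha
      subst ha
      exact absurd hab (hi b hb)
    · intro a ha b hb hab
      simp only [List.singleton_append, List.head?_cons, Option.mem_some_iff] at hb
      subst hb
      simp only [FreeGroup.invRev, List.getLast?_reverse, List.head?_map, Option.mem_def,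
        Option.map_eq_some_iff] at ha
      obtain ⟨c, hc, rfl⟩ := ha
      exact absurd hab.symm (hi c hc)
  have hmk : w⁻¹ * FreeGroup.of i * w =
      FreeGroup.mk (FreeGroup.invRev w.toWord ++ ([(i, true)] ++ w.toWord)) := by
    rw [← FreeGroup.mul_mk, ← FreeGroup.mul_mk, ← FreeGroup.inv_mk, FreeGroup.mk_toWord,
      mul_assoc]
    rfl
  refine ⟨i, ?_⟩
  rw [hmk, FreeGroup.norm, FreeGroup.toWord_mk, hred.reduce_eq, FreeGroup.norm]
  simp only [List.length_append, FreeGroup.invRev_length, List.length_singleton]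
  omega

/-- If $x'_i = v^{-1} x_i v$ for bases $x, x'$ of $F_n$ ($n ≥ 2$) and a basis $y$, then
$|x|_y ≤ 2 |x'|_y^2 |y|_x + |x'|_y$. -/
theorem basisNorm_le_of_conjugate {n : ℕ} (hn : 2 ≤ n) {G : Type*} [Group G]
    (x y x' : Fin n → G) (hx : IsFreeBasis x) (hy : IsFreeBasis y) (hx' : IsFreeBasis x')
    (v : G) (hv : ∀ i : Fin n, x' i = v⁻¹ * x i * v) :
    basisNorm y x ≤ 2 * (basisNorm y x') ^ 2 * basisNorm x y + basisNorm y x' := by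
  have : Nontrivial (Fin n) := Fin.nontrivial_iff_two_le.2 hn
  obtain ⟨w, hw⟩ := hy.2 v
  obtain ⟨i, hi⟩ := FreeGroup.exists_norm_conj_of w
  have hlen : 2 * wordLength y v + 1 ≤ basisNorm x y * basisNorm y x' := by
    obtain ⟨u, hu, hnu⟩ := hx.exists_lift_eq (y i)
    calc 2 * wordLength y v + 1
        = wordLength y (FreeGroup.lift x' u) := by
          rw [FreeGroup.lift_conj hv, hu, ← hw, hy.wordLength_lift, ← hi, ← hy.wordLength_lift]
          simp
      _ ≤ u.norm * basisNorm y x' := hy.wordLength_lift_le_mul x' u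
      _ ≤ basisNorm x y * basisNorm y x' :=
          Nat.mul_le_mul_right _ (hnu.trans_le (wordLength_le_basisNorm x y i))
  have hpos : 0 < basisNorm y x' := Nat.pos_of_ne_zero fun h => by simp [h] at hlen
  have hmul : basisNorm x y * basisNorm y x' ≤ 2 * basisNorm y x' ^ 2 * basisNorm x y := by
    nlinarith [Nat.mul_le_mul_left (basisNorm x y * basisNorm y x') hpos]
  refine Finset.sup_le fun j _ => ?_
  have hxj : x j = v * x' j * v⁻¹ := by
    rw [hv]
    group
  have h1 := hy.wordLength_mul_le (v * x' j) v⁻¹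
  have h2 := hy.wordLength_mul_le v (x' j)
  have h3 := wordLength_le_basisNorm y x' j
  rw [hy.wordLength_inv, ← hxj] at h1
  omega
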